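/- Let R be a left hereditary ring, i.e. every submodule of a projective left R-module is projective. Then every cochain complex X of left R-modules with Xⁱ = 0 for all but finitely many i is isomorphic, in the derived category of left R-modules, to the direct sum ⊕ᵢ Hⁱ(X)[−i] of its cohomology modules, each regarded as a complex concentrated in its respective degree. In particular, every indecomposable object of the bounded derived category of R-modules is isomorphic to a shift of a module. (Theorem of Dold, used throughout the paper.) -/

import Mathlib

open CategoryTheory Limits

attribute [local instance] HasDerivedCategory.standard

variable (R : Type) [Ring R]

/-- The complex having the cohomology modules `Hⁱ(X)` in the respective degrees
and zero differentials; this is the direct sum `⊕ᵢ Hⁱ(X)[−i]`. -/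
noncomputable def cohomologyComplex (X : CochainComplex (ModuleCat R) ℤ) :
    CochainComplex (ModuleCat R) ℤ where
  X i := X.homology i
  d _ _ := 0
  shape _ _ _ := rfl
  d_comp_d' := by intros; simp

universe w u v

/-- If all left ideals are projective then quotients of injective modules are injective. -/
theorem dold_injective_of_epi (R : Type) [Ring R]
    (hR : ∀ (P : Type) [AddCommGroup P] [Module R P], Module.Projective R P →
      ∀ N : Submodule R P, Module.Projective R N)
    {I J : ModuleCat.{w} R} (p : I ⟶ J) [Epi p] [hI : Injective I] : Injective J := by
  have hI' : Module.Injective R I := (Module.injective_iff_injective_object R I).2 hI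
  have hB : Module.Baer R I := Module.Baer.of_injective hI'
  have hJ : Module.Baer R J := by
    intro K g
    have := hR R inferInstance K
    obtain ⟨h, hh⟩ := Module.projective_lifting_property p.hom g
      ((ModuleCat.epi_iff_surjective p).1 inferInstance)
    obtain ⟨h', hh'⟩ := hB K h
    refine ⟨p.hom ∘ₗ h', fun x hx => ?_⟩
    rw [LinearMap.comp_apply, hh' x hx, ← hh]
    rfl
  exact (Module.injective_iff_injective_object R J).1 hJ.injective

section

variable {C : Type u} [Category.{w} C] [Abelian C]

/-- The zero differential complex on the cohomology. -/
noncomputable def doldH (X : CochainComplex C ℤ) : CochainComplex C ℤ where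
  X i := X.homology i
  d _ _ := 0
  shape _ _ _ := rfl
  d_comp_d' := by intros; simp

/-- The auxiliary complex with terms `I n ⊞ J n` and differential given by `π`. -/
noncomputable def doldW (I J : ℤ → C) (π : ∀ j i : ℤ, i + 1 = j → (I i ⟶ J j)) :
    CochainComplex C ℤ where
  X n := I n ⊞ J n
  d i j := if h : i + 1 = j then biprod.fst ≫ π j i h ≫ biprod.inr else 0
  shape i j h := dif_neg h
  d_comp_d' i j k hij hjk := by
    have hij' : i + 1 = j := hij
    have hjk' : j + 1 = k := hjk
    rw [dif_pos hij', dif_pos hjk']; simp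

theorem doldW_exists (I J : ℤ → C) (π : ∀ j i : ℤ, i + 1 = j → (I i ⟶ J j)) :
    ∃ (W : CochainComplex C ℤ) (fst : ∀ n, W.X n ⟶ I n) (snd : ∀ n, W.X n ⟶ J n)
      (inl : ∀ n, I n ⟶ W.X n) (inr : ∀ n, J n ⟶ W.X n),
      (∀ n, inl n ≫ fst n = 𝟙 _) ∧ (∀ n, inl n ≫ snd n = 0) ∧
      (∀ n, inr n ≫ fst n = 0) ∧ (∀ n, inr n ≫ snd n = 𝟙 _) ∧
      (∀ n {A : C} (a b : A ⟶ W.X n), a ≫ fst n = b ≫ fst n → a ≫ snd n = b ≫ snd n → a = b) ∧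
      (∀ i j (h : i + 1 = j), W.d i j = fst i ≫ π j i h ≫ inr j) :=
  ⟨doldW I J π, fun _ => biprod.fst, fun _ => biprod.snd, fun _ => biprod.inl,
    fun _ => biprod.inr, fun _ => biprod.inl_fst, fun _ => biprod.inl_snd,
    fun _ => biprod.inr_fst, fun _ => biprod.inr_snd, fun _ _ a b => biprod.hom_ext a b,
    fun _ _ h => dif_pos h⟩

theorem dold_data (hC : ∀ {I J : C} (p : I ⟶ J) [Epi p] [Injective I], Injective J)
    [EnoughInjectives C] (X : CochainComplex C ℤ) :
    ∃ (I J : ℤ → C) (ι : ∀ n, X.homology n ⟶ I n) (t : ∀ n, X.opcycles n ⟶ I n)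
      (e : ∀ n, X.X n ⟶ J n) (π : ∀ j i : ℤ, i + 1 = j → (I i ⟶ J j)),
      (∀ n, Mono (ι n)) ∧ (∀ n, X.homologyι n ≫ t n = ι n) ∧
      (∀ j i h, Epi (π j i h)) ∧
      (∀ j i h, ∃ w : ι i ≫ π j i h = 0, (ShortComplex.mk _ _ w).Exact) ∧
      (∀ j i h, X.fromOpcycles i j ≫ e j = t i ≫ π j i h) := by
  have h1 : ∀ n, ∃ (I : C) (ι : X.homology n ⟶ I) (t : X.opcycles n ⟶ I), Injective I ∧
      Mono ι ∧ X.homologyι n ≫ t = ι := fun n => by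
    obtain ⟨⟨I, hI, ι, hι⟩⟩ := EnoughInjectives.presentation (X.homology n)
    exact ⟨I, ι, Injective.factorThru ι (X.homologyι n), hI, hι, Injective.comp_factorThru _ _⟩
  choose I ι t hI hι ht using h1
  have h2 : ∀ j, ∃ (J : C) (e : X.X j ⟶ J), ∀ i (_ : i + 1 = j), ∃ (π : I i ⟶ J),
      Epi π ∧ (∃ w : ι i ≫ π = 0, (ShortComplex.mk _ _ w).Exact) ∧
      X.fromOpcycles i j ≫ e = t i ≫ π := by
    intro j
    obtain ⟨i, rfl⟩ : ∃ i, j = i + 1 := ⟨j - 1, by omega⟩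
    have := hI i
    have : Injective (cokernel (ι i)) := hC (cokernel.π (ι i))
    have hex := ShortComplex.exact_of_f_is_kernel
      (ShortComplex.mk (X.homologyι i) (X.fromOpcycles i (i + 1)) (by simp))
      (X.homologyIsKernel i (i + 1) (by simp))
    have hz : X.homologyι i ≫ t i ≫ cokernel.π (ι i) = 0 := by
      rw [← Category.assoc, ht, cokernel.condition]
    refine ⟨cokernel (ι i), hex.descToInjective (t i ≫ cokernel.π (ι i)) hz, ?_⟩
    intro i' hi'
    obtain rfl : i = i' := by omega
    exact ⟨cokernel.π (ι i), inferInstance, ⟨cokernel.condition _,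
      ShortComplex.exact_of_g_is_cokernel _ (cokernelIsCokernel _)⟩,
      hex.comp_descToInjective _ hz⟩
  choose J e π h3 h4 h5 using h2
  exact ⟨I, J, ι, t, e, π, hι, ht, h3, h4, h5⟩

theorem dold_quasiIsos (hC : ∀ {I J : C} (p : I ⟶ J) [Epi p] [Injective I], Injective J)
    [EnoughInjectives C] (X H : CochainComplex C ℤ) (hH : ∀ i j, H.d i j = 0)
    (κ : ∀ n, H.X n ≅ X.homology n) :
    ∃ (W : CochainComplex C ℤ) (f : X ⟶ W) (g : H ⟶ W), QuasiIso f ∧ QuasiIso g := by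
  obtain ⟨I, J, ι, t, e, π, hι, ht, hπ, hex, he⟩ := dold_data hC X
  have hιπ : ∀ j i h, ι i ≫ π j i h = 0 := fun j i h => (hex j i h).1
  obtain ⟨W, fst, snd, inl, inr, h11, h12, h21, h22, hext, hd⟩ := doldW_exists I J π
  let f : X ⟶ W :=
    { f := fun n => X.pOpcycles n ≫ t n ≫ inl n + e n ≫ inr n
      comm' := by
        intro i j (hij : i + 1 = j)
        rw [hd i j hij]
        simp [reassoc_of% h11, reassoc_of% h21, ← reassoc_of% (he j i hij)] }
  let g : H ⟶ W :=
    { f := fun n => (κ n).hom ≫ ι n ≫ inl n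
      comm' := by
        intro i j (hij : i + 1 = j)
        rw [hd i j hij, hH]
        simp [reassoc_of% h11, reassoc_of% (hιπ j i hij)] }
  have hf1 : ∀ n, f.f n ≫ fst n = X.pOpcycles n ≫ t n := fun n => by simp [f, h11, h21]
  have hf2 : ∀ n, f.f n ≫ snd n = e n := fun n => by simp [f, h12, h22]
  have hg1 : ∀ n, g.f n ≫ fst n = (κ n).hom ≫ ι n := fun n => by simp [g, h11]
  have hg2 : ∀ n, g.f n ≫ snd n = 0 := fun n => by simp [g, h12]
  have hd1 : ∀ i j, i + 1 = j → W.d i j ≫ fst j = 0 := fun i j h => by simp [hd i j h, h21]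
  have hd2 : ∀ i j h, W.d i j ≫ snd j = fst i ≫ π j i h := fun i j h => by simp [hd i j h, h22]
  -- cycles of `W`
  have hcyc : ∀ n {A : C} (y : A ⟶ W.X n), y ≫ W.d n (n + 1) = 0 →
      ∃ h : A ⟶ X.homology n, h ≫ ι n = y ≫ fst n := by
    intro n A y hy
    have hy' : (y ≫ fst n) ≫ π (n + 1) n rfl = 0 := by
      rw [Category.assoc, ← hd2, ← Category.assoc, hy, zero_comp]
    obtain ⟨w, hw⟩ := hex (n + 1) n rfl
    have := hι n
    exact ⟨hw.lift _ hy', hw.lift_f _ hy'⟩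
  refine ⟨W, f, g, ⟨fun n => ?_⟩, ⟨fun n => ?_⟩⟩
  · rw [quasiIsoAt_iff_isIso_homologyMap]
    have hp : (ComplexShape.up ℤ).prev n = n - 1 := by simp
    have hn : (ComplexShape.up ℤ).next n = n + 1 := by simp
    have hn' : n - 1 + 1 = n := by omega
    have : Mono (HomologicalComplex.homologyMap f n) := by
      rw [HomologicalComplex.mono_homologyMap_iff_up_to_refinements f (n - 1) n (n + 1) hp hn]
      intro A x hx y hy
      have h1 : (x ≫ X.pOpcycles n) ≫ t n = 0 := by
        rw [Category.assoc, ← hf1, ← Category.assoc, hy, Category.assoc, hd1 _ _ hn', comp_zero]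
      have hexX := ShortComplex.exact_of_f_is_kernel
        (ShortComplex.mk (X.homologyι n) (X.fromOpcycles n (n + 1)) (by simp))
        (X.homologyIsKernel n (n + 1) hn)
      have h2 : (x ≫ X.pOpcycles n) ≫ X.fromOpcycles n (n + 1) = 0 := by simpa using hx
      obtain ⟨h, hh⟩ : ∃ h, h ≫ X.homologyι n = x ≫ X.pOpcycles n :=
        ⟨hexX.lift _ h2, hexX.lift_f _ h2⟩
      have h3 : h = 0 := by
        have := hι n
        rw [← cancel_mono (ι n), ← ht, ← Category.assoc, hh, h1, zero_comp]
      have h4 : x ≫ X.pOpcycles n = 0 := by rw [← hh, h3, zero_comp]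
      have hexY := ShortComplex.exact_of_g_is_cokernel
        (ShortComplex.mk (X.d (n - 1) n) (X.pOpcycles n) (by simp))
        (X.opcyclesIsCokernel (n - 1) n hp)
      exact (ShortComplex.exact_iff_exact_up_to_refinements _).1 hexY x h4
    have : Epi (HomologicalComplex.homologyMap f n) := by
      rw [HomologicalComplex.epi_homologyMap_iff_up_to_refinements f (n - 1) n (n + 1) hp hn]
      intro A y hy
      obtain ⟨h, hh⟩ := hcyc n y hy
      obtain ⟨A', p, hp, c, hc⟩ := surjective_up_to_refinements_of_epi (X.homologyπ n) h
      have := hπ n (n - 1) hn'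
      obtain ⟨A'', q, hq, z, hz⟩ := surjective_up_to_refinements_of_epi (π n (n - 1) hn')
        (p ≫ y ≫ snd n - c ≫ X.iCycles n ≫ e n)
      refine ⟨A'', q ≫ p, inferInstance, q ≫ c ≫ X.iCycles n, by simp,
        z ≫ inl (n - 1), ?_⟩
      apply hext
      · simp only [Category.assoc, Preadditive.add_comp, hf1, hd1 _ _ hn', comp_zero, add_zero]
        rw [← hh, reassoc_of% hc, ← ht, HomologicalComplex.homology_π_ι_assoc]
      · simp only [Category.assoc, Preadditive.add_comp, hf2, hd2 _ _ hn', reassoc_of% h11]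
        rw [← hz]
        simp
    exact isIso_of_mono_of_epi _
  · rw [quasiIsoAt_iff_isIso_homologyMap]
    have hp : (ComplexShape.up ℤ).prev n = n - 1 := by simp
    have hn : (ComplexShape.up ℤ).next n = n + 1 := by simp
    have hn' : n - 1 + 1 = n := by omega
    have : Mono (HomologicalComplex.homologyMap g n) := by
      rw [HomologicalComplex.mono_homologyMap_iff_up_to_refinements g (n - 1) n (n + 1) hp hn]
      intro A x hx y hy
      have h1 : x ≫ (κ n).hom ≫ ι n = 0 := by
        rw [← hg1, ← Category.assoc, hy, Category.assoc, hd1 _ _ hn', comp_zero]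
      have := hι n
      have h2 : x = 0 := (cancel_mono ((κ n).hom ≫ ι n)).1 (h1.trans zero_comp.symm)
      exact ⟨A, 𝟙 A, inferInstance, 0, by simp [h2]⟩
    have : Epi (HomologicalComplex.homologyMap g n) := by
      rw [HomologicalComplex.epi_homologyMap_iff_up_to_refinements g (n - 1) n (n + 1) hp hn]
      intro A y hy
      obtain ⟨h, hh⟩ := hcyc n y hy
      have := hπ n (n - 1) hn'
      obtain ⟨A'', q, hq, z, hz⟩ := surjective_up_to_refinements_of_epi (π n (n - 1) hn')
        (y ≫ snd n)
      refine ⟨A'', q, inferInstance, q ≫ h ≫ (κ n).inv, by simp [hH],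
        z ≫ inl (n - 1), ?_⟩
      apply hext
      · simp [hg1, hd1 _ _ hn', hh]
      · simp [hg2, hd2 _ _ hn', hz, reassoc_of% h11]
    exact isIso_of_mono_of_epi _

theorem dold_iso [HasDerivedCategory.{v} C]
    (hC : ∀ {I J : C} (p : I ⟶ J) [Epi p] [Injective I], Injective J)
    [EnoughInjectives C] (X : CochainComplex C ℤ) :
    Nonempty (DerivedCategory.Q.obj X ≅ DerivedCategory.Q.obj (doldH X)) := by
  obtain ⟨W, f, g, hf, hg⟩ := dold_quasiIsos hC X (doldH X) (fun _ _ => rfl)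
    (fun _ => Iso.refl _)
  exact ⟨asIso (DerivedCategory.Q.map f) ≪≫ (asIso (DerivedCategory.Q.map g)).symm⟩

theorem dold_retract (H : CochainComplex C ℤ) (hH : ∀ i j, H.d i j = 0) (i : ℤ) :
    ∃ (s : (HomologicalComplex.single C (ComplexShape.up ℤ) i).obj (H.X i) ⟶ H)
      (r : H ⟶ (HomologicalComplex.single C (ComplexShape.up ℤ) i).obj (H.X i)), s ≫ r = 𝟙 _ := by
  refine ⟨HomologicalComplex.mkHomFromSingle (𝟙 _) (fun _ _ => by simp [hH]),
    HomologicalComplex.mkHomToSingle (𝟙 _) (fun _ _ => by simp [hH]), ?_⟩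
  apply HomologicalComplex.from_single_hom_ext
  rw [HomologicalComplex.comp_f, HomologicalComplex.mkHomFromSingle_f,
    HomologicalComplex.mkHomToSingle_f]
  simp

theorem dold_indec [HasDerivedCategory.{v} C]
    (hC : ∀ {I J : C} (p : I ⟶ J) [Epi p] [Injective I], Injective J)
    [EnoughInjectives C] (X : CochainComplex C ℤ)
    (h0 : ¬ IsZero (DerivedCategory.Q.obj X))
    (hX : ∀ A B : DerivedCategory C,
          Nonempty (DerivedCategory.Q.obj X ≅ A ⊞ B) → IsZero A ∨ IsZero B) :
    ∃ (M : C) (i : ℤ), Nonempty (DerivedCategory.Q.obj X ≅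
          (DerivedCategory.singleFunctor C i).obj M) := by
  obtain ⟨φ⟩ := dold_iso hC X
  obtain ⟨i, hi⟩ : ∃ i, ¬ IsZero (X.homology i) := by
    by_contra! hcon
    apply h0
    refine IsZero.of_iso ?_ φ
    have hz : IsZero (doldH X) := by
      rw [IsZero.iff_id_eq_zero]
      ext n
      exact (hcon n).eq_of_src _ _
    exact Functor.map_isZero _ hz
  refine ⟨X.homology i, i, ?_⟩
  obtain ⟨s, r, hsr⟩ := dold_retract (doldH X) (fun _ _ => rfl) i
  have : IsSplitMono s := ⟨⟨⟨r, hsr⟩⟩⟩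
  let b := biprod.uniqueUpToIso _ _
    (isBilimitBinaryBiconeOfIsSplitMonoOfCokernel (cokernelIsCokernel s))
  have hP : PreservesBinaryBiproducts (DerivedCategory.Q (C := C)) :=
    preservesBinaryBiproducts_of_preservesBiproducts _
  let ψ := φ ≪≫ DerivedCategory.Q.mapIso b ≪≫ DerivedCategory.Q.mapBiprod _ _
  rcases hX _ _ ⟨ψ⟩ with hA | hB
  · exfalso
    apply hi
    have h1 := Functor.map_isZero (DerivedCategory.homologyFunctor C i) hA
    have h2 := h1.of_iso ((DerivedCategory.homologyFunctorFactors C i).symm.app _)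
    exact h2.of_iso (HomologicalComplex.singleObjHomologySelfIso _ i _).symm
  · exact ⟨ψ ≪≫ (isoBiprodZero hB).symm ≪≫
      ((DerivedCategory.singleFunctorIsoCompQ C i).app _).symm⟩

end

/-- theorem of Dold: if `R` is left hereditary then every cochain
complex of `R`-modules with only finitely many nonzero terms is isomorphic, in the
derived category, to the direct sum of its (shifted) cohomology modules, i.e. to
the complex with the same cohomology and zero differentials; in particular every
indecomposable object of the bounded derived category is a shift of a module. -/
theorem stmt16 (R : Type) [Ring R]
    (hR : ∀ (P : Type) [AddCommGroup P] [Module R P], Module.Projective R P →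
      ∀ N : Submodule R P, Module.Projective R N) :
    (∀ X : CochainComplex (ModuleCat R) ℤ, {i : ℤ | ¬ IsZero (X.X i)}.Finite →
      Nonempty (DerivedCategory.Q.obj X ≅ DerivedCategory.Q.obj (cohomologyComplex R X))) ∧
    (∀ X : CochainComplex (ModuleCat R) ℤ, {i : ℤ | ¬ IsZero (X.X i)}.Finite →
      (¬ IsZero (DerivedCategory.Q.obj X) ∧
        ∀ A B : DerivedCategory (ModuleCat R),
          Nonempty (DerivedCategory.Q.obj X ≅ A ⊞ B) → IsZero A ∨ IsZero B) →
      ∃ (M : ModuleCat R) (i : ℤ),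
        Nonempty (DerivedCategory.Q.obj X ≅
          (DerivedCategory.singleFunctor (ModuleCat R) i).obj M)) := by
  exact ⟨fun X _ => dold_iso (dold_injective_of_epi R hR) X,
    fun X _ h => dold_indec (dold_injective_of_epi R hR) X h.1 h.2⟩
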